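/- There is no density matrix ρ on ℂ²⊗ℂ² such that Tr[ρ (σ₁ ⊗ σ₁)] = 1, Tr[ρ (σ₁ ⊗ σ₂)] = 1, Tr[ρ (σ₂ ⊗ σ₁)] = 0, and Tr[ρ (σ₂ ⊗ σ₂)] = 0; that is, the local-realistically admissible correlations C₁₁ = C₁₂ = 1, C₂₁ = C₂₂ = 0 (which satisfy all CHSH inequalities) are not quantum realizable for the fixed anti-commuting observables A₁ = B₁ = σ₁, A₂ = B₂ = σ₂. -/

import Mathlib

open Matrix Kronecker Real ComplexOrder

noncomputable section

def σ1 : Matrix (Fin 2) (Fin 2) ℂ := !![0, 1; 1, 0]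
def σ2 : Matrix (Fin 2) (Fin 2) ℂ := !![0, -Complex.I; Complex.I, 0]
def σ3 : Matrix (Fin 2) (Fin 2) ℂ := !![1, 0; 0, -1]

/-- For `a ∈ ℝ³`, `a·σ := a₁σ₁ + a₂σ₂ + a₃σ₃`. -/
def dotSigma (a : Fin 3 → ℝ) : Matrix (Fin 2) (Fin 2) ℂ :=
  (a 0 : ℂ) • σ1 + (a 1 : ℂ) • σ2 + (a 2 : ℂ) • σ3

/-- Euclidean dot product on `ℝ³`. -/
def dot3 (a b : Fin 3 → ℝ) : ℝ := a 0 * b 0 + a 1 * b 1 + a 2 * b 2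

/-- A density matrix on `ℂ² ⊗ ℂ²`: positive semidefinite with trace 1. -/
def IsDensityMatrix (ρ : Matrix (Fin 2 × Fin 2) (Fin 2 × Fin 2) ℂ) : Prop :=
  ρ.PosSemidef ∧ ρ.trace = 1

/-- The matrix `F_{α,β}`. -/
def Fmat (α β : ℝ) : Matrix (Fin 4) (Fin 4) ℝ :=
  (1 / (Real.sin α ^ 2 * Real.sin β ^ 2)) •
    !![1, -Real.cos α, -Real.cos β, Real.cos (α + β);
       -Real.cos α, 1, Real.cos (α - β), -Real.cos β;
       -Real.cos β, Real.cos (α - β), 1, -Real.cos α;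
       Real.cos (α + β), -Real.cos β, -Real.cos α, 1]

/-- The quadratic form `γᵀ F_{α,β} γ`. -/
def quadForm (α β : ℝ) (γ : Fin 4 → ℝ) : ℝ := γ ⬝ᵥ (Fmat α β *ᵥ γ)

/-- The local-realistically admissible correlations
`C₁₁ = C₁₂ = 1`, `C₂₁ = C₂₂ = 0` are not quantum realizable for the fixed
anti-commuting observables `A₁ = B₁ = σ₁`, `A₂ = B₂ = σ₂`. -/
theorem stmt7 :
    ¬ ∃ ρ : Matrix (Fin 2 × Fin 2) (Fin 2 × Fin 2) ℂ, IsDensityMatrix ρ ∧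
        (ρ * (σ1 ⊗ₖ σ1)).trace = 1 ∧
        (ρ * (σ1 ⊗ₖ σ2)).trace = 1 ∧
        (ρ * (σ2 ⊗ₖ σ1)).trace = 0 ∧
        (ρ * (σ2 ⊗ₖ σ2)).trace = 0 := by
  rintro ⟨ρ, ⟨hρ, htr⟩, h11, h12, -, -⟩
  -- Evaluate the state on two vectors whose sum of values is `1 - 3/5 C₁₁ - 4/5 C₁₂`.
  have p1 := hρ.dotProduct_mulVec_nonneg
    (fun p => !![1, 0; 0, -(3 + 4 * Complex.I) / 5] p.1 p.2)
  have p2 := hρ.dotProduct_mulVec_nonneg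
    (fun p => !![0, 1; -(3 - 4 * Complex.I) / 5, 0] p.1 p.2)
  have hs := add_nonneg p1 p2
  simp only [Matrix.trace, Matrix.diag, Matrix.mul_apply, dotProduct, mulVec,
    Fintype.sum_prod_type, Fin.sum_univ_two, kroneckerMap_apply, σ1, σ2, Pi.star_apply,
    Matrix.of_apply, Matrix.cons_val', Matrix.cons_val_zero, Matrix.cons_val_one,
    Matrix.cons_val_fin_one] at hs htr h11 h12
  simp at hs htr h11 h12
  have key := le_of_le_of_eq hs (b := _) (c := ((-(2 / 5) : ℝ) : ℂ)) (by
    push_cast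
    linear_combination (exp := 1) htr - (3 / 5) * h11 - (4 / 5) * h12 +
      (-16 / 25 * (ρ (1, 1) (1, 1) + ρ (1, 0) (1, 0))) * Complex.I_sq)
  have := Complex.zero_le_real.mp key
  norm_num at this
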